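/- Let b ≥ 2 be an integer base. For every n ≥ 1, K(n+1) > b·K(n), except that when b ≥ 5 is odd and n = 2 only the weaker inequality K(3) > (b−1)·K(2) is asserted. -/

import Mathlib

namespace Kaprekar

/-- Sum of the digits of `v` in base `b`. -/
def s (b v : ℕ) : ℕ := (Nat.digits b v).sum

/-- `f v = v + s v`. -/
def f (b v : ℕ) : ℕ := v + s b v

/-- `F u` is the number of generators of `u`. -/
noncomputable def F (b u : ℕ) : ℕ := Set.ncard {v : ℕ | f b v = u}

/-- `K n` is the least `u` with exactly `n` generators. -/
noncomputable def K (b n : ℕ) : ℕ := sInf {u : ℕ | F b u = n}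

lemma s_zero (b : ℕ) : s b 0 = 0 := by simp [s]

lemma f_zero (b : ℕ) : f b 0 = 0 := by simp [f, s_zero]

lemma s_eq_mod_add_div {b : ℕ} (hb : 2 ≤ b) (v : ℕ) : s b v = v % b + s b (v / b) := by
  rcases Nat.eq_zero_or_pos v with rfl | hv
  · simp [s]
  · simp [s, Nat.digits_def' (by omega : 1 < b) hv]

lemma s_of_lt {b : ℕ} (hb : 2 ≤ b) {v : ℕ} (hv : v < b) : s b v = v := by
  rw [s_eq_mod_add_div hb, Nat.mod_eq_of_lt hv, Nat.div_eq_of_lt hv, s_zero, add_zero]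

lemma s_pos {b v : ℕ} (hb : 2 ≤ b) (hv : 0 < v) : 0 < s b v := by
  induction v using Nat.strong_induction_on with
  | _ v ih =>
    rw [s_eq_mod_add_div hb]
    rcases Nat.eq_zero_or_pos (v / b) with h | h
    · have := Nat.div_add_mod v b
      rw [h] at this
      omega
    · have := ih (v / b) (Nat.div_lt_self hv (by omega)) h
      omega

lemma s_mul_pow_add {b : ℕ} (hb : 2 ≤ b) (a k w : ℕ) (hw : w < b ^ k) :
    s b (a * b ^ k + w) = s b a + s b w := by
  induction k generalizing w with
  | zero =>
    have : w = 0 := by simpa using hw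
    simp [this, s_zero]
  | succ k ih =>
    rw [s_eq_mod_add_div hb, s_eq_mod_add_div hb w]
    have h : a * b ^ (k + 1) + w = w + b * (a * b ^ k) := by ring
    rw [h, Nat.add_mul_mod_self_left, Nat.add_mul_div_left _ _ (by omega), add_comm (w / b),
      ih _ (Nat.div_lt_of_lt_mul (by rwa [pow_succ'] at hw))]
    omega

/-- Complementing all `k` digits. -/
lemma s_add_s_compl {b : ℕ} (hb : 2 ≤ b) (k w w' : ℕ) (h : w + w' + 1 = b ^ k) :
    s b w + s b w' = k * (b - 1) := by
  induction k generalizing w w' with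
  | zero =>
    have h1 : w = 0 := by simp at h; omega
    have h2 : w' = 0 := by simp at h; omega
    simp [h1, h2, s_zero]
  | succ k ih =>
    rw [s_eq_mod_add_div hb w, s_eq_mod_add_div hb w']
    have e1 := Nat.div_add_mod w b
    have e2 := Nat.div_add_mod w' b
    have l1 := Nat.mod_lt w (by omega : b > 0)
    have l2 := Nat.mod_lt w' (by omega : b > 0)
    have key : w / b + w' / b + 1 = b ^ k ∧ w % b + w' % b + 1 = b := by
      have e3 : b * (w / b + w' / b) + (w % b + w' % b + 1) = b * b ^ k := by
        rw [← pow_succ', ← h]; linarith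
      have h1 : w / b + w' / b + 1 = b ^ k := by
        apply le_antisymm
        · by_contra! hc
          have := Nat.mul_le_mul_left b (Nat.lt_succ_iff.1 hc)
          omega
        · by_contra! hc
          have := Nat.mul_le_mul_left b (Nat.succ_le_of_lt hc)
          rw [Nat.succ_eq_add_one, add_assoc, Nat.mul_add] at this
          omega
      refine ⟨h1, ?_⟩
      rw [← h1] at e3
      linarith
    have := ih _ _ key.1
    rw [Nat.succ_mul]
    omega

lemma s_le_of_lt_pow {b : ℕ} (hb : 2 ≤ b) {k w : ℕ} (hw : w < b ^ k) :
    s b w ≤ k * (b - 1) := by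
  have := s_add_s_compl hb k w (b ^ k - 1 - w) (by omega)
  omega

lemma even_f {b : ℕ} (hb : Odd b) (v : ℕ) : Even (f b v) := by
  have h := Nat.modEq_digits_sum 2 b (Nat.odd_iff.1 hb) v
  rw [Nat.even_iff]
  simp only [f, s]
  unfold Nat.ModEq at h
  omega

lemma finite_generators (b u : ℕ) : {v : ℕ | f b v = u}.Finite :=
  (Set.finite_Iic u).subset fun v hv => by
    simp only [Set.mem_ofPred_eq, f] at hv
    simp only [Set.mem_Iic]
    omega

lemma exists_generator {b u : ℕ} (h : 1 ≤ F b u) : ∃ v, f b v = u := by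
  by_contra! hc
  have : {v : ℕ | f b v = u} = ∅ := by
    ext v; simp [hc v]
  simp [F, this] at h

lemma F_pos {b u v : ℕ} (h : f b v = u) : 1 ≤ F b u :=
  (Set.ncard_pos (finite_generators b u)).2 ⟨v, h⟩

lemma F_zero (b : ℕ) : F b 0 = 1 := by
  rw [F, Set.ncard_eq_one]
  refine ⟨0, ?_⟩
  ext v
  simp only [Set.mem_ofPred_eq, Set.mem_singleton_iff]
  constructor
  · intro h; simp only [f] at h; omega
  · rintro rfl; exact f_zero b

lemma F_one {b : ℕ} (hb : 2 ≤ b) : F b 1 = 0 := by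
  by_contra h
  obtain ⟨v, hv⟩ := exists_generator (Nat.one_le_iff_ne_zero.2 h)
  simp only [f] at hv
  rcases Nat.eq_zero_or_pos v with rfl | h0
  · simp [s_zero] at hv
  · have := s_pos hb h0; omega

lemma mul_pred_lt_pow {b : ℕ} (hb : 2 ≤ b) (k : ℕ) : k * (b - 1) < b ^ k := by
  obtain ⟨d, rfl⟩ : ∃ d, b = d + 1 := ⟨b - 1, by omega⟩
  have := one_add_mul_le_pow (R := ℤ) (a := d) (by omega) k
  zify
  push_cast [Nat.add_sub_cancel]
  rw [add_comm (d : ℤ) 1]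
  linarith

lemma mul_pred_lt_pow_pred {b : ℕ} (hb : 2 ≤ b) (j : ℕ) : (j + 3) * (b - 1) < b ^ (j + 2) + 2 := by
  obtain ⟨d, rfl⟩ : ∃ d, b = d + 1 := ⟨b - 1, by omega⟩
  simp only [Nat.add_sub_cancel]
  induction j with
  | zero => norm_num; nlinarith [Nat.le_self_pow two_ne_zero d]
  | succ j ih =>
    have h1 : d + 1 ≤ (d + 1) ^ (j + 2) := Nat.le_self_pow (by omega) _
    have h2 : (d + 1) ^ (j + 1 + 2) = (d + 1) ^ (j + 2) * d + (d + 1) ^ (j + 2) := by ring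
    have h3 : (d + 1) ^ (j + 2) ≤ (d + 1) ^ (j + 2) * d := Nat.le_mul_of_pos_right _ (by omega)
    have h4 : (j + 1 + 3) * d = (j + 3) * d + d := by ring
    omega

lemma f_mul_pow_add {b : ℕ} (hb : 2 ≤ b) {a k w : ℕ} (ha : a < b) (hw : w < b ^ k) :
    f b (a * b ^ k + w) = a * (b ^ k + 1) + f b w := by
  rw [f, f, s_mul_pow_add hb a k w hw, s_of_lt hb ha]
  ring

lemma lt_pow_of_f_le {b : ℕ} (hb : 2 ≤ b) {k w : ℕ} (hw : f b w ≤ b ^ k) : w < b ^ k := by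
  have h0 : 0 < b ^ k := by positivity
  rcases Nat.eq_zero_or_pos w with rfl | h
  · exact h0
  · have := s_pos hb h
    simp only [f] at hw
    omega

lemma lt_of_mul_le_pow {b c k r : ℕ} (hb : 2 ≤ b) (h : c * (b ^ k + 1) + r ≤ b ^ (k + 1)) :
    c < b := by
  by_contra! hcb
  have := Nat.mul_le_mul_right (b ^ k + 1) hcb
  have : b ^ (k + 1) = b * b ^ k := pow_succ' _ _
  rw [this] at h
  nlinarith

/-- A generator of `c * (b ^ k + 1) + r` has leading digit `c` or `c - 1`. -/
lemma generator_cases {b : ℕ} (hb : 2 ≤ b) {c k r v : ℕ} (hc : 1 ≤ c) (hr : r ≤ b ^ k)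
    (hu : c * (b ^ k + 1) + r ≤ b ^ (k + 1)) (hv : f b v = c * (b ^ k + 1) + r) :
    (∃ w, w < b ^ k ∧ v = c * b ^ k + w ∧ f b w = r) ∨
    (∃ w, w < b ^ k ∧ v + w + 1 = c * b ^ k ∧ f b w + r + 2 = k * (b - 1)) := by
  have hvlt : v < b ^ (k + 1) := lt_pow_of_f_le hb (hv ▸ hu)
  have h0 : 0 < b ^ k := by positivity
  have e := Nat.div_add_mod' v (b ^ k)
  have hw := Nat.mod_lt v h0
  have ha : v / b ^ k < b := Nat.div_lt_of_lt_mul (by rwa [pow_succ] at hvlt)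
  generalize v / b ^ k = a at *
  generalize v % b ^ k = w at *
  rw [← e, f_mul_pow_add hb ha hw] at hv
  have hsw := s_le_of_lt_pow hb hw
  have hk := mul_pred_lt_pow hb k
  have hac : a ≤ c := by
    by_contra! h
    have := Nat.mul_le_mul_right (b ^ k + 1) (Nat.succ_le_of_lt h)
    rw [Nat.succ_mul] at this
    omega
  have hca : c ≤ a + 1 := by
    by_contra! h
    have := Nat.mul_le_mul_right (b ^ k + 1) (Nat.succ_le_of_lt h)
    rw [Nat.succ_mul, Nat.succ_mul] at this
    simp only [f] at hv
    omega
  rcases hac.eq_or_lt with h | h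
  · left
    refine ⟨w, hw, by rw [← h, e], ?_⟩
    rw [h] at hv
    omega
  · right
    obtain rfl : c = a + 1 := by omega
    have hs := s_add_s_compl hb k w (b ^ k - 1 - w) (by omega)
    have h1 : (a + 1) * b ^ k = a * b ^ k + b ^ k := Nat.succ_mul _ _
    have h2 : (a + 1) * (b ^ k + 1) = a * (b ^ k + 1) + (b ^ k + 1) := Nat.succ_mul _ _
    refine ⟨b ^ k - 1 - w, by omega, by omega, ?_⟩
    simp only [f] at *
    omega

theorem F_junction_of_lt {b : ℕ} (hb : 2 ≤ b) {c k r : ℕ} (hc : 1 ≤ c) (hr : r ≤ b ^ k)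
    (hu : c * (b ^ k + 1) + r ≤ b ^ (k + 1)) (h : k * (b - 1) < r + 2) :
    F b (c * (b ^ k + 1) + r) = F b r := by
  have hcb := lt_of_mul_le_pow hb hu
  have : {v | f b v = c * (b ^ k + 1) + r} = (fun w => c * b ^ k + w) '' {w | f b w = r} := by
    ext v
    simp only [Set.mem_ofPred_eq, Set.mem_image]
    constructor
    · intro hv
      rcases generator_cases hb hc hr hu hv with ⟨w, -, h1, h2⟩ | ⟨w, -, -, h2⟩
      · exact ⟨w, h2, h1.symm⟩
      · omega
    · rintro ⟨w, hw, rfl⟩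
      rw [f_mul_pow_add hb hcb (lt_pow_of_f_le hb (hw ▸ hr)), hw]
  rw [F, this, Set.ncard_image_of_injective _ (add_right_injective _), F]

theorem F_junction {b : ℕ} (hb : 2 ≤ b) {c k x y : ℕ} (hc : 1 ≤ c)
    (hu : c * (b ^ k + 1) + x ≤ b ^ (k + 1)) (h : x + y + 2 = k * (b - 1)) :
    F b (c * (b ^ k + 1) + x) = F b x + F b y := by
  have hcb := lt_of_mul_le_pow hb hu
  have hk := mul_pred_lt_pow hb k
  have hx : x ≤ b ^ k := by omega
  have hcB : b ^ k ≤ c * b ^ k := Nat.le_mul_of_pos_left _ hc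
  have hlt : ∀ w, f b w = y → w < b ^ k := fun w hw => lt_pow_of_f_le hb (by omega)
  have : {v | f b v = c * (b ^ k + 1) + x} = (fun w => c * b ^ k + w) '' {w | f b w = x} ∪
      (fun w => c * b ^ k - 1 - w) '' {w | f b w = y} := by
    ext v
    simp only [Set.mem_ofPred_eq, Set.mem_image, Set.mem_union]
    constructor
    · intro hv
      rcases generator_cases hb hc hx hu hv with ⟨w, -, h1, h2⟩ | ⟨w, -, h1, h2⟩
      · exact Or.inl ⟨w, h2, h1.symm⟩
      · exact Or.inr ⟨w, by omega, by omega⟩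
    · rintro (⟨w, hw, rfl⟩ | ⟨w, hw, rfl⟩)
      · rw [f_mul_pow_add hb hcb (lt_pow_of_f_le hb (hw ▸ hx)), hw]
      · have hwlt := hlt w hw
        obtain ⟨a, rfl⟩ : ∃ a, c = a + 1 := ⟨c - 1, by omega⟩
        have e : (a + 1) * b ^ k - 1 - w = a * b ^ k + (b ^ k - 1 - w) := by
          rw [Nat.succ_mul]; omega
        have hs := s_add_s_compl hb k w (b ^ k - 1 - w) (by omega)
        rw [e, f_mul_pow_add hb (by omega) (by omega), Nat.succ_mul]
        simp only [f] at *
        omega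
  rw [F, this, Set.ncard_union_eq _ ((finite_generators b x).image _)
    ((finite_generators b y).image _),
    Set.ncard_image_of_injective _ (add_right_injective _), Set.InjOn.ncard_image _, F, F]
  · intro w hw w' hw' he
    have := hlt w hw
    have := hlt w' hw'
    simp only at he
    omega
  · rw [Set.disjoint_left]
    rintro _ ⟨w, hw, rfl⟩ ⟨w', hw', he⟩
    have := hlt w' hw'
    simp only at he
    omega

theorem F_first_junction {b : ℕ} (hb : 2 ≤ b) {k x y : ℕ} (h : x + y + 2 = k * (b - 1)) :
    F b (b ^ k + 1 + x) = F b x + F b y := by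
  have hk := mul_pred_lt_pow hb k
  have h2 : 2 * b ^ k ≤ b * b ^ k := Nat.mul_le_mul_right _ hb
  have := F_junction hb (c := 1) le_rfl (by rw [pow_succ']; omega) h
  rwa [one_mul] at this

lemma F_two_mul {b : ℕ} (hb : 2 ≤ b) {v : ℕ} (hv : 2 * v ≤ b) : F b (2 * v) = 1 := by
  rcases Nat.eq_zero_or_pos v with rfl | h
  · exact F_zero b
  · have := F_junction_of_lt hb (c := v) (k := 0) (r := 0) h (by simp) (by simp; omega) (by simp)
    rw [F_zero] at this
    rw [← this]
    congr 1
    simp; ring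

lemma K_le {b n u : ℕ} (h : F b u = n) : K b n ≤ u := Nat.sInf_le h

lemma F_K {b n : ℕ} (hex : ∀ m, 1 ≤ m → ∃ u : ℕ, F b u = m) (hn : 1 ≤ n) :
    F b (K b n) = n :=
  Nat.sInf_mem (s := {u : ℕ | F b u = n}) (hex n hn)

/-- For `n ≥ 2` the generators of `K b n` lie on both sides of a power of `b`. -/
theorem exists_K_eq_pow_add {b n : ℕ} (hb : 2 ≤ b) (hex : ∀ m, 1 ≤ m → ∃ u : ℕ, F b u = m)
    (hn : 2 ≤ n) : ∃ k x y, K b n = b ^ k + 1 + x ∧ x + y + 2 = k * (b - 1) ∧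
      F b x + F b y = n ∧ 1 ≤ F b x ∧ 1 ≤ F b y := by
  have hF := F_K hex (by omega : 1 ≤ n)
  have hmin : ∀ u, F b u = n → K b n ≤ u := fun u => K_le
  generalize K b n = u at *
  have hu0 : u ≠ 0 := by rintro rfl; rw [F_zero] at hF; omega
  have hu1 : u ≠ 1 := by rintro rfl; rw [F_one hb] at hF; omega
  have hlo := Nat.pow_log_le_self b (by omega : u - 1 ≠ 0)
  have hhi := Nat.lt_pow_succ_log_self (by omega : 1 < b) (u - 1)
  rw [Nat.succ_eq_add_one] at hhi
  generalize Nat.log b (u - 1) = k at *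
  have e := Nat.div_add_mod' u (b ^ k + 1)
  have hr := Nat.mod_lt u (by omega : b ^ k + 1 > 0)
  have hc : 1 ≤ u / (b ^ k + 1) := Nat.div_pos (by omega) (by omega)
  generalize u / (b ^ k + 1) = c at *
  generalize u % (b ^ k + 1) = r at *
  have hcB : b ^ k + 1 ≤ c * (b ^ k + 1) := Nat.le_mul_of_pos_left _ hc
  have hk := mul_pred_lt_pow hb k
  subst e
  rcases lt_or_ge (k * (b - 1)) (r + 2) with h | h
  · rw [F_junction_of_lt hb hc (by omega) (by omega) h] at hF
    have := hmin _ hF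
    omega
  · obtain ⟨y, hy⟩ := Nat.exists_eq_add_of_le h
    have hy' : r + y + 2 = k * (b - 1) := by omega
    rw [F_junction hb hc (by omega) hy'] at hF
    have hle := hmin _ ((F_first_junction hb hy').trans hF)
    refine ⟨k, r, y, by omega, hy', hF, ?_, ?_⟩
    · by_contra! h0
      have := hmin y (by omega)
      omega
    · by_contra! h0
      have := hmin r (by omega)
      omega

lemma succ_le_K {b n : ℕ} (hb : 2 ≤ b) (hex : ∀ m, 1 ≤ m → ∃ u : ℕ, F b u = m)
    (hn : 2 ≤ n) : b + 1 ≤ K b n := by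
  obtain ⟨k, x, y, h, hk, -⟩ := exists_K_eq_pow_add hb hex hn
  have hk0 : k ≠ 0 := by rintro rfl; omega
  have := Nat.le_self_pow hk0 b
  omega

lemma even_of_F_pos {b x : ℕ} (hb : Odd b) (h : 1 ≤ F b x) : Even x := by
  obtain ⟨v, rfl⟩ := exists_generator h
  exact even_f hb v

lemma even_of_F_pos_of_lt {b x : ℕ} (hb : 2 ≤ b) (hx : x < b) (h : 1 ≤ F b x) : Even x := by
  obtain ⟨v, rfl⟩ := exists_generator h
  have hv : v < b := by simp only [f] at hx; omega
  rw [f, s_of_lt hb hv]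
  exact ⟨v, rfl⟩

lemma sq_add_one_le_K {b n : ℕ} (hb : 2 ≤ b) (hbe : Even b)
    (hex : ∀ m, 1 ≤ m → ∃ u : ℕ, F b u = m) (hn : 2 ≤ n) : b ^ 2 + 1 ≤ K b n := by
  obtain ⟨k, x, y, h, hk, -, hx, hy⟩ := exists_K_eq_pow_add hb hex hn
  have hk2 : 2 ≤ k := by
    by_contra! hlt
    interval_cases k
    · omega
    · obtain ⟨x', rfl⟩ := even_of_F_pos_of_lt hb (by omega) hx
      obtain ⟨y', rfl⟩ := even_of_F_pos_of_lt hb (by omega) hy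
      obtain ⟨b', rfl⟩ := hbe
      omega
  have := Nat.pow_le_pow_right (by omega : 0 < b) hk2
  omega

lemma exists_lt_add_modEq {m : ℕ} (hm : 0 < m) (x z : ℕ) :
    ∃ e < m, e + x ≡ z [MOD m] := by
  refine ⟨(z + (m - 1) * x) % m, Nat.mod_lt _ hm, ?_⟩
  refine ((Nat.mod_modEq _ _).add_right x).trans ?_
  obtain ⟨d, rfl⟩ : ∃ d, m = d + 1 := ⟨m - 1, by omega⟩
  have : z + (d + 1 - 1) * x + x = z + (d + 1) * x := by simp; ring
  rw [this]
  simp [Nat.ModEq]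

lemma exists_two_mul_add_modEq_of_odd {m : ℕ} (hm : Odd m) (x z : ℕ) :
    ∃ c, 1 ≤ c ∧ c ≤ m ∧ 2 * c + x ≡ z [MOD m] := by
  obtain ⟨h, rfl⟩ := hm
  obtain ⟨e, he, hez⟩ := exists_lt_add_modEq (by omega : 0 < 2 * h + 1) x z
  rcases Nat.even_or_odd' e with ⟨c, rfl | rfl⟩
  · rcases Nat.eq_zero_or_pos c with rfl | hc
    · refine ⟨2 * h + 1, by omega, le_rfl, Nat.ModEq.trans ?_ hez⟩
      simp [Nat.ModEq]
    · exact ⟨c, hc, by omega, hez⟩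
  · refine ⟨c + h + 1, by omega, by omega, Nat.ModEq.trans ?_ hez⟩
    have : 2 * (c + h + 1) + x = 2 * c + 1 + x + (2 * h + 1) := by ring
    rw [this]
    simp [Nat.ModEq]

lemma exists_two_mul_add_modEq_of_even {h : ℕ} (hh : 0 < h) {x z : ℕ} (hx : Even x)
    (hz : Even z) : ∃ c, 1 ≤ c ∧ c ≤ h ∧ 2 * c + x ≡ z [MOD 2 * h] := by
  obtain ⟨e, he, hez⟩ := exists_lt_add_modEq (by omega : 0 < 2 * h) x z
  have h2 : e + x ≡ z [MOD 2] := hez.of_dvd (Dvd.intro _ rfl)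
  have he2 : Even e := by
    unfold Nat.ModEq at h2
    rw [Nat.even_iff] at *
    omega
  obtain ⟨c, rfl⟩ := he2.exists_two_nsmul
  simp only [smul_eq_mul] at *
  rcases Nat.eq_zero_or_pos c with rfl | hc
  · refine ⟨h, hh, le_rfl, Nat.ModEq.trans ?_ hez⟩
    simp [Nat.ModEq]
  · exact ⟨c, hc, by omega, hez⟩

lemma mul_pow_add_one_modEq {b : ℕ} (hb : 2 ≤ b) (c k x : ℕ) :
    c * (b ^ k + 1) + x ≡ 2 * c + x [MOD b - 1] := by
  have h1 : b ≡ 1 [MOD b - 1] := by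
    have := Nat.modEq_iff_dvd' (n := b - 1) (by omega : 1 ≤ b)
    exact (this.2 dvd_rfl).symm
  have h2 := (((h1.pow k).add_right 1).mul_left c).add_right x
  rw [one_pow] at h2
  rwa [mul_comm 2 c]

lemma exists_descent_two_of_even {b z : ℕ} (hb : 2 ≤ b) (hbe : Even b)
    (hex : ∀ m, 1 ≤ m → ∃ u : ℕ, F b u = m) (hz : F b z = 2) :
    ∃ z', F b z' = 1 ∧ z' ≡ z [MOD b - 1] ∧ z' + 2 * (b - 1) ≤ z := by
  have hbo : Odd (b - 1) := by
    obtain ⟨a, rfl⟩ := hbe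
    exact ⟨a - 1, by omega⟩
  obtain ⟨c, hc1, hc2, hc⟩ := exists_two_mul_add_modEq_of_odd hbo 0 z
  have hzK := (sq_add_one_le_K hb hbe hex le_rfl).trans (K_le hz)
  obtain ⟨v, hv, hvc⟩ : ∃ v, v + 2 ≤ b ∧ 2 * v ≡ z [MOD b - 1] := by
    rcases eq_or_lt_of_le hc2 with h | h
    · refine ⟨0, by omega, Nat.ModEq.trans ?_ hc⟩
      rw [h]
      simp [Nat.ModEq]
    · exact ⟨c, by omega, hc⟩
  refine ⟨2 * v, ?_, hvc, ?_⟩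
  · have hpos : 1 ≤ F b (2 * v) := F_pos (v := v) (by rw [f, s_of_lt hb (by omega)]; ring)
    by_contra hne
    have h1 := sq_add_one_le_K hb hbe hex (by omega : 2 ≤ F b (2 * v))
    have h2 := K_le (b := b) (u := 2 * v) rfl
    nlinarith
  · obtain ⟨d, rfl⟩ : ∃ d, b = d + 2 := ⟨b - 2, by omega⟩
    have : (d + 2) ^ 2 = d * d + 4 * d + 4 := by ring
    omega


lemma exists_descent_of_even {b t z : ℕ} (hb : 2 ≤ b) (hbe : Even b)
    (hex : ∀ m, 1 ≤ m → ∃ u : ℕ, F b u = m) (ht : 2 ≤ t) (hK : b * K b t < K b (t + 1))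
    (hz : F b z = t + 1) :
    ∃ z', F b z' = t ∧ z' ≡ z [MOD b - 1] ∧ z' + 2 * (b - 1) ≤ z := by
  obtain ⟨k, x, y, hKt, hk, hF, -⟩ := exists_K_eq_pow_add hb hex ht
  have hKlo := sq_add_one_le_K hb hbe hex ht
  have hzK := K_le hz
  have hbo : Odd (b - 1) := by
    obtain ⟨a, rfl⟩ := hbe
    exact ⟨a - 1, by omega⟩
  have hlt := mul_pred_lt_pow hb k
  have hk2 : 2 ≤ k := by
    by_contra! h
    have : b ^ k ≤ b ^ 1 := Nat.pow_le_pow_right (by omega) (by omega)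
    nlinarith
  obtain ⟨j, rfl⟩ := Nat.exists_eq_add_of_le' hk2
  have hj := mul_pred_lt_pow_pred hb j
  obtain ⟨c, hc1, hc2, hc⟩ := exists_two_mul_add_modEq_of_odd hbo x z
  obtain ⟨d, rfl⟩ : ∃ d, b = d + 2 := ⟨b - 2, by omega⟩
  simp only [show d + 2 - 1 = d + 1 by omega] at *
  have hcm := Nat.mul_le_mul_right ((d + 2) ^ (j + 2) + 1) hc2
  refine ⟨c * ((d + 2) ^ (j + 2) + 1) + x, ?_, ?_, ?_⟩
  · rw [F_junction hb hc1 _ hk, hF]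
    rw [pow_succ' _ (j + 2)]
    nlinarith
  · exact (mul_pow_add_one_modEq hb c (j + 2) x).trans hc
  · rw [hKt] at hK hKlo
    nlinarith

lemma exists_descent_of_odd {b t z : ℕ} (hb : 2 ≤ b) (hbo : Odd b)
    (hex : ∀ m, 1 ≤ m → ∃ u : ℕ, F b u = m) (ht : 2 ≤ t) (hK : (b - 1) * K b t < K b (t + 1))
    (hz : F b z = t + 1) :
    ∃ z', F b z' = t ∧ z' ≡ z [MOD b - 1] ∧ z' + 2 * (b - 1) ≤ z := by
  obtain ⟨k, x, y, hKt, hk, hF, hx, -⟩ := exists_K_eq_pow_add hb hex ht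
  have hKlo := succ_le_K hb hex ht
  have hzK := K_le hz
  have hlt := mul_pred_lt_pow hb k
  obtain ⟨h, rfl⟩ := hbo
  simp only [Nat.add_sub_cancel] at *
  obtain ⟨c, hc1, hc2, hc⟩ := exists_two_mul_add_modEq_of_even (by omega : 0 < h)
    (even_of_F_pos ⟨h, rfl⟩ hx) (even_of_F_pos (x := z) ⟨h, rfl⟩ (by omega))
  have hcm := Nat.mul_le_mul_right ((2 * h + 1) ^ k + 1) hc2
  refine ⟨c * ((2 * h + 1) ^ k + 1) + x, ?_, ?_, ?_⟩
  · rw [F_junction hb hc1 _ hk, hF]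
    rw [pow_succ']
    nlinarith
  · simpa using (mul_pow_add_one_modEq hb c k x).trans hc
  · rw [hKt] at hK hKlo
    nlinarith

lemma mul_K_lt_pow_of_descent {b k z w t z' : ℕ} (hb : 2 ≤ b) (hk : z + w + 2 = k * (b - 1))
    (hF : F b z' = t) (hmod : z' ≡ z [MOD b - 1]) (hz' : z' + 2 * (b - 1) ≤ z) :
    b * K b (t + F b w) < b ^ k := by
  obtain ⟨m, hm⟩ := (Nat.modEq_iff_dvd' (by omega)).1 hmod
  obtain ⟨d, rfl⟩ : ∃ d, b = d + 2 := ⟨b - 2, by omega⟩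
  simp only [show d + 2 - 1 = d + 1 by omega] at *
  have hz : z = z' + (d + 1) * m := by omega
  have hm2 : 2 ≤ m := by
    by_contra! h
    have := Nat.mul_le_mul_left (d + 1) (Nat.le_of_lt_succ h)
    omega
  have hmk : m ≤ k := by
    by_contra! h
    have := Nat.mul_le_mul_right (d + 1) h.le
    rw [mul_comm m] at this
    omega
  obtain ⟨l, rfl⟩ := Nat.exists_eq_add_of_le' hmk
  have hl : z' + w + 2 = l * (d + 2 - 1) := by
    simp only [show d + 2 - 1 = d + 1 by omega]
    have : (l + m) * (d + 1) = l * (d + 1) + (d + 1) * m := by ring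
    omega
  have hKle := K_le ((F_first_junction hb hl).trans (by rw [hF]))
  have hlt := mul_pred_lt_pow hb l
  calc (d + 2) * K (d + 2) (t + F (d + 2) w) ≤ (d + 2) * ((d + 2) ^ l + 1 + z') :=
        Nat.mul_le_mul_left _ hKle
    _ < (d + 2) * ((d + 2) * (d + 2) ^ l) := by
        refine Nat.mul_lt_mul_of_pos_left ?_ (by omega)
        have : 2 * (d + 2) ^ l ≤ (d + 2) * (d + 2) ^ l := Nat.mul_le_mul_right _ hb
        omega
    _ = (d + 2) ^ (l + 2) := by ring
    _ ≤ (d + 2) ^ (l + m) := Nat.pow_le_pow_right (by omega) (by omega)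

lemma F_add_one_of_odd {b : ℕ} (hb : 3 ≤ b) (hbo : Odd b) : F b (b + 1) = 2 := by
  obtain ⟨h, rfl⟩ := hbo
  have h1 := F_first_junction (b := 2 * h + 1) (by omega) (k := 1) (x := 0) (y := 2 * (h - 1))
    (by omega)
  rw [F_zero, F_two_mul (by omega) (by omega)] at h1
  simpa using h1

lemma F_sq_add_one_of_odd {b : ℕ} (hb : 5 ≤ b) (hbo : Odd b) : F b (b ^ 2 + 1) = 3 := by
  obtain ⟨h, rfl⟩ := hbo
  have h1 := F_first_junction (b := 2 * h + 1) (by omega) (k := 1) (x := 2 * (h - 2)) (y := 2 * 1)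
    (by omega)
  rw [F_two_mul (by omega) (by omega), F_two_mul (by omega) (by omega)] at h1
  have h2 := F_first_junction (b := 2 * h + 1) (by omega) (k := 2) (x := 0)
    (y := (2 * h + 1) ^ 1 + 1 + 2 * (h - 2)) (by rw [pow_one]; omega)
  rw [F_zero, h1] at h2
  simpa using h2

lemma K_three_le_of_odd {b : ℕ} (hb : 5 ≤ b) (hbo : Odd b) : K b 3 ≤ b ^ 2 + 1 :=
  K_le (F_sq_add_one_of_odd hb hbo)

lemma K_three_three_le : K 3 3 ≤ 28 := by
  have h := F_first_junction (b := 3) (by omega) (k := 3) (x := 0) (y := 4) (by omega)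
  rw [F_zero, F_add_one_of_odd (b := 3) le_rfl ⟨1, rfl⟩] at h
  exact K_le h

lemma pred_mul_K_two_lt {b : ℕ} (hb : 5 ≤ b) (hbo : Odd b)
    (hex : ∀ m, 1 ≤ m → ∃ u : ℕ, F b u = m) : (b - 1) * K b 2 < K b 3 := by
  have hK2 := K_le (F_add_one_of_odd (by omega) hbo)
  obtain ⟨k, x, y, h, hk, hF, -, -⟩ := exists_K_eq_pow_add (n := 3) (by omega) hex (by omega)
  have hlow : ∀ z, 2 ≤ F b z → b + 1 ≤ z := fun z hz =>
    (succ_le_K (by omega) hex hz).trans (K_le rfl)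
  have hk2 : 2 ≤ k := by
    by_contra! hlt
    have : k * (b - 1) ≤ 1 * (b - 1) := Nat.mul_le_mul_right _ (by omega)
    rcases le_or_gt 2 (F b x) with hx | hx
    · have := hlow x hx; omega
    · have := hlow y (by omega); omega
  have hp := Nat.pow_le_pow_right (by omega : 0 < b) hk2
  have h2 := Nat.mul_le_mul_left (b - 1) hK2
  obtain ⟨d, rfl⟩ : ∃ d, b = d + 1 := ⟨b - 1, by omega⟩
  simp only [Nat.add_sub_cancel] at *
  nlinarith

lemma mul_K_three_lt_of_odd {b k x y : ℕ} (hb : 2 ≤ b) (hbo : Odd b)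
    (hex : ∀ m, 1 ≤ m → ∃ u : ℕ, F b u = m) (hk : x + y + 2 = k * (b - 1))
    (hx : F b x = 2) (hy : F b y = 2) : b * K b 3 < b ^ k + 1 + x := by
  have hx' := (succ_le_K hb hex le_rfl).trans (K_le hx)
  have hy' := (succ_le_K hb hex le_rfl).trans (K_le hy)
  have hb' : b = 3 ∨ 5 ≤ b := by
    obtain ⟨h, rfl⟩ := hbo
    omega
  rcases hb' with rfl | hb5
  · have := K_three_three_le
    have hp : 3 ^ 5 ≤ 3 ^ k := Nat.pow_le_pow_right (by omega) (by omega)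
    omega
  · have h3 := Nat.mul_le_mul_left b (K_three_le_of_odd hb5 hbo)
    have hk3 : 3 ≤ k := by
      by_contra! h
      have : k * (b - 1) ≤ 2 * (b - 1) := Nat.mul_le_mul_right _ (by omega)
      omega
    have hp : b ^ 3 ≤ b ^ k := Nat.pow_le_pow_right (by omega) hk3
    have : b * (b ^ 2 + 1) = b ^ 3 + b := by ring
    omega

/-- The case where one side of the junction carries all but one generator. -/
lemma mul_K_lt_pow_of_F_eq {b n k z : ℕ} (hb : 2 ≤ b)
    (hex : ∀ m, 1 ≤ m → ∃ u : ℕ, F b u = m) (hn : 2 ≤ n)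
    (hprev : 3 ≤ n → (b - 1) * K b (n - 1) < K b n)
    (hexc : ¬(Odd b ∧ 5 ≤ b ∧ n = 2)) (hz : F b z = n) (hk : z + 2 ≤ k * (b - 1)) :
    b * K b n < b ^ k := by
  have hKz := K_le hz
  have hk3 : 3 ≤ k := by
    by_contra! h
    have hk2 : k * (b - 1) ≤ 2 * (b - 1) := Nat.mul_le_mul_right _ (by omega)
    rcases Nat.even_or_odd b with hbe | hbo
    · have := sq_add_one_le_K hb hbe hex hn
      obtain ⟨d, rfl⟩ : ∃ d, b = d + 2 := ⟨b - 2, by omega⟩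
      have e : (d + 2) ^ 2 = d * d + 4 * d + 4 := by ring
      omega
    · rcases le_or_gt 3 n with h3 | h3
      · have h1 := hprev h3
        have h2 := Nat.mul_le_mul_left (b - 1) (succ_le_K hb hex (by omega : 2 ≤ n - 1))
        have h4 : (b - 1) * 2 ≤ (b - 1) * (b + 1) := Nat.mul_le_mul_left _ (by omega)
        omega
      · have := succ_le_K hb hex hn
        obtain ⟨h, rfl⟩ := hbo
        have : ¬ 5 ≤ 2 * h + 1 := fun h5 => hexc ⟨⟨h, rfl⟩, h5, by omega⟩
        omega
  obtain ⟨j, rfl⟩ := Nat.exists_eq_add_of_le' hk3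
  have hj := mul_pred_lt_pow_pred hb j
  rw [pow_succ' b (j + 2)]
  exact Nat.mul_lt_mul_of_pos_left (by omega) (by omega)

/-- The case where both sides of the junction carry at least two generators. -/
lemma mul_K_lt_pow_of_two_le {b n k z w : ℕ} (hb : 2 ≤ b)
    (hex : ∀ m, 1 ≤ m → ∃ u : ℕ, F b u = m) (hk : z + w + 2 = k * (b - 1))
    (hF : F b z + F b w = n + 1) (hz : 2 ≤ F b z) (hw : 2 ≤ F b w)
    (hz3 : Odd b → 3 ≤ F b z)
    (ih : ∀ m < n, 2 ≤ m → (¬(Odd b ∧ 5 ≤ b ∧ m = 2) → b * K b m < K b (m + 1)) ∧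
      (b - 1) * K b m < K b (m + 1)) :
    b * K b n < b ^ k := by
  obtain ⟨t, ht⟩ : ∃ t, F b z = t + 1 := ⟨F b z - 1, by omega⟩
  have hn : n = t + F b w := by omega
  suffices h : ∃ z', F b z' = t ∧ z' ≡ z [MOD b - 1] ∧ z' + 2 * (b - 1) ≤ z by
    obtain ⟨z', h1, h2, h3⟩ := h
    rw [hn]
    exact mul_K_lt_pow_of_descent hb hk h1 h2 h3
  rcases Nat.even_or_odd b with hbe | hbo
  · rcases le_or_gt 2 t with h2 | h2
    · exact exists_descent_of_even hb hbe hex h2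
        ((ih t (by omega) h2).1 fun h => Nat.not_odd_iff_even.2 hbe h.1) ht
    · obtain rfl : t = 1 := by omega
      exact exists_descent_two_of_even hb hbe hex ht
  · have := hz3 hbo
    exact exists_descent_of_odd hb hbo hex (by omega) (ih t (by omega) (by omega)).2 ht

theorem K_growth {b : ℕ} (hb : 2 ≤ b) (hex : ∀ m, 1 ≤ m → ∃ u : ℕ, F b u = m) (n : ℕ)
    (hn : 2 ≤ n) : (¬(Odd b ∧ 5 ≤ b ∧ n = 2) → b * K b n < K b (n + 1)) ∧
      (b - 1) * K b n < K b (n + 1) := by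
  induction n using Nat.strong_induction_on with
  | _ n ih =>
    by_cases hexc : Odd b ∧ 5 ≤ b ∧ n = 2
    · obtain ⟨hbo, hb5, rfl⟩ := hexc
      exact ⟨fun h => (h ⟨hbo, hb5, rfl⟩).elim, pred_mul_K_two_lt hb5 hbo hex⟩
    suffices h : b * K b n < K b (n + 1) from
      ⟨fun _ => h, (Nat.mul_le_mul_right _ (by omega)).trans_lt h⟩
    have hprev : 3 ≤ n → (b - 1) * K b (n - 1) < K b n := fun h3 => by
      have := (ih (n - 1) (by omega) (by omega)).2
      rwa [Nat.sub_add_cancel (by omega)] at this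
    obtain ⟨k, x, y, h, hk, hF, hx, hy⟩ :=
      exists_K_eq_pow_add hb hex (by omega : 2 ≤ n + 1)
    suffices b * K b n < b ^ k + 1 + x by rwa [h]
    suffices b * K b n < b ^ k ∨ b * K b n < b ^ k + 1 + x by omega
    rcases hy.eq_or_lt' with hy1 | hy2
    · exact Or.inl (mul_K_lt_pow_of_F_eq (z := x) hb hex hn hprev hexc (by omega) (by omega))
    rcases hx.eq_or_lt' with hx1 | hx2
    · exact Or.inl (mul_K_lt_pow_of_F_eq (z := y) hb hex hn hprev hexc (by omega) (by omega))
    by_cases hx3 : Odd b → 3 ≤ F b x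
    · exact Or.inl (mul_K_lt_pow_of_two_le hb hex hk hF hx2 hy2 hx3 ih)
    by_cases hy3 : Odd b → 3 ≤ F b y
    · exact Or.inl (mul_K_lt_pow_of_two_le hb hex (by omega : y + x + 2 = k * (b - 1))
        (by omega) hy2 hx2 hy3 ih)
    push Not at hx3 hy3
    obtain rfl : n = 3 := by omega
    exact Or.inr (mul_K_three_lt_of_odd hb hx3.1 hex hk (by omega) (by omega))

theorem stmt19 (b : ℕ) (hb : 2 ≤ b)
    (hex : ∀ m, 1 ≤ m → ∃ u : ℕ, F b u = m) :
    (∀ n, 1 ≤ n → ¬(Odd b ∧ 5 ≤ b ∧ n = 2) → b * K b n < K b (n + 1)) ∧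
    (Odd b → 5 ≤ b → (b - 1) * K b 2 < K b 3) := by
  refine ⟨fun n hn hexc => ?_, fun hbo hb5 => (K_growth hb hex 2 le_rfl).2⟩
  rcases hn.eq_or_lt' with rfl | h2
  · have h1 : K b 1 = 0 := Nat.le_zero.1 (K_le (F_zero b))
    have := succ_le_K hb hex (le_refl (1 + 1))
    rw [h1]
    omega
  · exact (K_growth hb hex n h2).1 hexc

end Kaprekar
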